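/- arXiv:1401.2621 — 3 statements merged into one kernel-verified Lean document; each statement's English description precedes it below -/
import Mathlib

section
/- Let M be an inverse monoid acting on a set Q by injective partial functions via act : M → Q → Option Q, let q₁ ∈ Q, and let H be a closed inverse submonoid of M that is conjugate to Stab(q₁), i.e. there exists m ∈ M such that m⁻¹ * s * m ∈ H for all s ∈ Stab(q₁) and m * h * m⁻¹ ∈ Stab(q₁) for all h ∈ H. Then there exists q₂ ∈ Q with H = Stab(q₂); indeed act m q₁ = some q₂ for this q₂. -/
/-- `i` is the inverse operation of an inverse monoid structure on `M`. -/
def IsInverseMonoidInv (M : Type*) [Monoid M] (i : M → M) : Prop :=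
  (∀ a : M, a * i a * a = a) ∧ (∀ a : M, i a * a * i a = i a) ∧
    ∀ a b : M, a * b * a = a → b * a * b = b → b = i a

/-- The natural partial order on an inverse monoid. -/
def natLe {M : Type*} [Monoid M] (a b : M) : Prop :=
  ∃ e : M, e * e = e ∧ a = e * b

/-- `N^ω`, the set of elements lying above some element of `N`. -/
def omegaClosure {M : Type*} [Monoid M] (N : Set M) : Set M :=
  {m | ∃ n ∈ N, natLe n m}

/-- `H` is a closed inverse submonoid of the inverse monoid `M`. -/
def IsClosedInvSubmonoid {M : Type*} [Monoid M] (i : M → M) (H : Set M) : Prop :=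
  (1 : M) ∈ H ∧ (∀ a ∈ H, ∀ b ∈ H, a * b ∈ H) ∧ (∀ a ∈ H, i a ∈ H) ∧
    omegaClosure H ⊆ H

/-- `act` is an action of the monoid `M` on the set `Q` by injective partial
functions. -/
def IsPartialAction {M Q : Type*} [Monoid M] (act : M → Q → Option Q) : Prop :=
  (∀ q : Q, act 1 q = some q) ∧
  (∀ (m n : M) (q : Q), act (m * n) q = (act m q).bind (act n)) ∧
  (∀ (m : M) (q₁ q₂ r : Q), act m q₁ = some r → act m q₂ = some r → q₁ = q₂)

theorem idem_mul_idem {M : Type*} [Monoid M] (i : M → M)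
    (hi : IsInverseMonoidInv M i) (e f : M) (he : e * e = e) (hf : f * f = f) :
    (e * f) * (e * f) = e * f := by
  obtain ⟨h1, h2, h3⟩ := hi
  have a1 := h1 (e * f)
  have a2 := h2 (e * f)
  have hx : f * i (e * f) * e = i (e * f) := by
    apply h3
    · calc e * f * (f * i (e * f) * e) * (e * f)
          = e * (f * f) * i (e * f) * (e * e) * f := by simp only [mul_assoc]
        _ = e * f * i (e * f) * (e * f) := by rw [he, hf]; simp only [mul_assoc]
        _ = e * f := a1
    · calc f * i (e * f) * e * (e * f) * (f * i (e * f) * e)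
          = f * i (e * f) * (e * e) * (f * f) * i (e * f) * e := by simp only [mul_assoc]
        _ = f * (i (e * f) * (e * f) * i (e * f)) * e := by
            rw [he, hf]; simp only [mul_assoc]
        _ = f * i (e * f) * e := by rw [a2]
  have hxx : i (e * f) * i (e * f) = i (e * f) := by
    calc i (e * f) * i (e * f) = (f * i (e * f) * e) * (f * i (e * f) * e) := by rw [hx]
      _ = f * (i (e * f) * (e * f) * i (e * f)) * e := by simp only [mul_assoc]
      _ = i (e * f) := by rw [a2, hx]
  have b1 : i (e * f) = i (i (e * f)) := h3 _ _ (by rw [hxx, hxx]) (by rw [hxx, hxx])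
  have b2 : e * f = i (i (e * f)) := h3 _ _ a2 a1
  have b3 : e * f = i (e * f) := b2.trans b1.symm
  rw [← b3] at hxx
  exact hxx

theorem idem_comm {M : Type*} [Monoid M] (i : M → M)
    (hi : IsInverseMonoidInv M i) (e f : M) (he : e * e = e) (hf : f * f = f) :
    e * f = f * e := by
  have aux : ∀ e f : M, e * e = e → f * f = f → e * f * (f * e) * (e * f) = e * f := by
    intro e f he hf
    calc e * f * (f * e) * (e * f) = e * (f * f) * (e * e) * f := by simp only [mul_assoc]
      _ = (e * f) * (e * f) := by rw [he, hf]; simp only [mul_assoc]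
      _ = e * f := idem_mul_idem i hi e f he hf
  have c1 := hi.2.2 (f * e) (e * f) (aux f e hf he) (aux e f he hf)
  have sq := idem_mul_idem i hi f e hf he
  have c2 := hi.2.2 (f * e) (f * e) (by rw [sq, sq]) (by rw [sq, sq])
  exact c1.trans c2.symm

/-- If a closed inverse submonoid `H` of `M` is conjugate (via `m`) to the
stabilizer of a point `q₁`, then `H` is itself the stabilizer of a point `q₂`,
namely the image of `q₁` under `m`. -/
theorem conjugate_of_stab_is_stab {M Q : Type*} [Monoid M] (i : M → M)
    (hi : IsInverseMonoidInv M i) (act : M → Q → Option Q)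
    (hact : IsPartialAction act) (q₁ : Q) (H : Set M)
    (hH : IsClosedInvSubmonoid i H) (m : M)
    (h₁ : ∀ s ∈ {n : M | act n q₁ = some q₁}, i m * s * m ∈ H)
    (h₂ : ∀ h ∈ H, m * h * i m ∈ {n : M | act n q₁ = some q₁}) :
    ∃ q₂ : Q, act m q₁ = some q₂ ∧ H = {n : M | act n q₂ = some q₂} := by
  obtain ⟨hone, hmul, hinj⟩ := hact
  obtain ⟨H1, -, -, Hc⟩ := hH
  have key : ∀ h ∈ H, ∃ q r, act m q₁ = some q ∧ act h q = some r ∧ act (i m) r = some q₁ := by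
    intro h hh
    have := h₂ h hh
    simp only [Set.mem_setOf_eq, hmul, Option.bind_eq_some_iff] at this
    obtain ⟨r, ⟨q, h1, h2⟩, h3⟩ := this
    exact ⟨q, r, h1, h2, h3⟩
  obtain ⟨q, r, hq, hr, hq'⟩ := key 1 H1
  rw [hone] at hr
  cases hr
  refine ⟨q, hq, Set.Subset.antisymm ?_ ?_⟩
  · intro h hh
    obtain ⟨q', r, h1, h2, h3⟩ := key h hh
    rw [hq] at h1
    cases h1
    rw [hinj _ _ _ _ h3 hq'] at h2
    exact h2
  · intro n hn
    have hn' : act n q = some q := hn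
    have hs := h₁ (m * n * i m) (by simp [hmul, hq, hn', hq'])
    have hf : (i m * m) * (i m * m) = i m * m := by rw [← mul_assoc, hi.2.1]
    have hg : (i n * n) * (i n * n) = i n * n := by rw [← mul_assoc, hi.2.1]
    have hc := idem_comm i hi _ _ hf hg
    have hnn : n * (i n * n) = n := by rw [← mul_assoc, hi.1]
    have s1 : n * (i m * m) ∈ H :=
      Hc ⟨_, hs, i m * m, hf, by simp only [mul_assoc]⟩
    generalize i m * m = f at *
    refine Hc ⟨_, s1, n * f * i n, ?_, ?_⟩
    · calc n * f * i n * (n * f * i n) = n * (f * (i n * n)) * f * i n := by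
            simp only [mul_assoc]
        _ = (n * (i n * n)) * (f * f) * i n := by rw [hc]; simp only [mul_assoc]
        _ = n * f * i n := by rw [hnn, hf]
    · calc n * f = (n * (i n * n)) * f := by rw [hnn]
        _ = n * (f * (i n * n)) := by rw [hc]; simp only [mul_assoc]
        _ = n * f * i n * n := by simp only [mul_assoc]
end

section
/- Let H be a closed inverse submonoid of an inverse monoid M, let Y and Z be right ω-cosets of H, and let m ∈ M. If (Y · m)^ω and (Z · m)^ω are again right ω-cosets of H and (Y · m)^ω = (Z · m)^ω, then Y = Z. (That is, for each m ∈ M the partial map Y ↦ (Y m)^ω, defined on those right ω-cosets Y for which (Y m)^ω is again a right ω-coset, is injective, so the action of M on the right ω-cosets of H is by injective partial functions.) -/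
/-- `Y` is a right ω-coset of `H`: `Y = (H a)^ω` for some `a` with `a * a⁻¹ ∈ H`. -/
def IsRightOmegaCoset {M : Type*} [Monoid M] (i : M → M) (H Y : Set M) : Prop :=
  ∃ a : M, a * i a ∈ H ∧ Y = omegaClosure ((· * a) '' H)

section helpers
variable {M : Type*} [Monoid M] {i : M → M}

theorem aux_inv_inv (hi : IsInverseMonoidInv M i) (a : M) : i (i a) = a :=
  (hi.2.2 (i a) a (hi.2.1 a) (hi.1 a)).symm

theorem aux_inv_idem (hi : IsInverseMonoidInv M i) {e : M} (he : e * e = e) : i e = e :=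
  (hi.2.2 e e (by rw [he, he]) (by rw [he, he])).symm

theorem aux_idem_mul (hi : IsInverseMonoidInv M i) {e f : M} (he : e * e = e) (hf : f * f = f) :
    (e * f) * (e * f) = e * f := by
  have h1 := hi.1 (e * f)
  have h2 := hi.2.1 (e * f)
  have h4 := aux_inv_inv hi (e * f)
  have h3 := hi.2.2 (e * f) (f * i (e * f) * e)
  generalize i (e * f) = x at h1 h2 h3 h4
  have hx : f * x * e = x := by
    apply h3
    · calc e * f * (f * x * e) * (e * f) = e * (f * f) * x * ((e * e) * f) := by
            simp only [mul_assoc]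
        _ = e * f := by rw [he, hf, h1]
    · calc f * x * e * (e * f) * (f * x * e) = f * (x * ((e * e) * (f * f)) * x) * e := by
            simp only [mul_assoc]
        _ = f * x * e := by rw [he, hf, h2]
  have hxx : x * x = x := by
    calc x * x = (f * x * e) * (f * x * e) := by rw [hx]
      _ = f * (x * (e * f) * x) * e := by simp only [mul_assoc]
      _ = x := by rw [h2, hx]
  have : x = e * f := by rw [← h4, aux_inv_idem hi hxx]
  rw [← this, hxx]

theorem aux_comm (hi : IsInverseMonoidInv M i) {e f : M} (he : e * e = e) (hf : f * f = f) :
    e * f = f * e := by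
  have h1 := aux_idem_mul hi he hf
  have h2 := aux_idem_mul hi hf he
  have h3 : f * e = i (e * f) := by
    apply hi.2.2
    · calc e * f * (f * e) * (e * f) = e * (f * f) * ((e * e) * f) := by simp only [mul_assoc]
        _ = e * f := by rw [he, hf, h1]
    · calc f * e * (e * f) * (f * e) = f * (e * e) * ((f * f) * e) := by simp only [mul_assoc]
        _ = f * e := by rw [he, hf, h2]
  rw [h3, aux_inv_idem hi h1]

theorem aux_idem_r (hi : IsInverseMonoidInv M i) (a : M) : (i a * a) * (i a * a) = i a * a := by
  rw [← mul_assoc, hi.2.1]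

theorem aux_idem_l (hi : IsInverseMonoidInv M i) (a : M) : (a * i a) * (a * i a) = a * i a := by
  rw [← mul_assoc, hi.1]

theorem aux_conj (hi : IsInverseMonoidInv M i) (x : M) {e : M} (he : e * e = e) :
    (x * e * i x) * (x * e * i x) = x * e * i x := by
  calc (x * e * i x) * (x * e * i x) = x * (e * (i x * x)) * e * i x := by simp only [mul_assoc]
    _ = (x * i x * x) * (e * e) * i x := by
      rw [aux_comm hi he (aux_idem_r hi x)]; simp only [mul_assoc]
    _ = x * e * i x := by rw [he, hi.1]

theorem aux_le (hi : IsInverseMonoidInv M i) (x y : M) {e : M} (he : e * e = e) :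
    natLe (x * e * y) (x * y) := by
  refine ⟨x * e * i x, aux_conj hi x he, ?_⟩
  calc x * e * y = (x * i x * x) * e * y := by rw [hi.1]
    _ = x * ((i x * x) * e) * y := by simp only [mul_assoc]
    _ = x * e * i x * (x * y) := by
      rw [aux_comm hi (aux_idem_r hi x) he]; simp only [mul_assoc]

theorem aux_inv_mul (hi : IsInverseMonoidInv M i) (a b : M) : i (a * b) = i b * i a := by
  symm
  apply hi.2.2
  · calc a * b * (i b * i a) * (a * b) = a * ((b * i b) * (i a * a)) * b := by
          simp only [mul_assoc]
      _ = (a * i a * a) * (b * i b * b) := by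
          rw [aux_comm hi (aux_idem_l hi b) (aux_idem_r hi a)]; simp only [mul_assoc]
      _ = a * b := by rw [hi.1, hi.1]
  · calc i b * i a * (a * b) * (i b * i a) = i b * ((i a * a) * (b * i b)) * i a := by
          simp only [mul_assoc]
      _ = (i b * b * i b) * (i a * a * i a) := by
          rw [← aux_comm hi (aux_idem_l hi b) (aux_idem_r hi a)]; simp only [mul_assoc]
      _ = i b * i a := by rw [hi.2.1, hi.2.1]

theorem aux_cancel (hi : IsInverseMonoidInv M i) {H : Set M} (hH : IsClosedInvSubmonoid i H)
    {x e y : M} (he : e * e = e) (h : x * e * y ∈ H) : x * y ∈ H :=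
  hH.2.2.2 ⟨_, h, aux_le hi x y he⟩

theorem aux_mem (hi : IsInverseMonoidInv M i) {H : Set M} (hH : IsClosedInvSubmonoid i H)
    {a : M} (ha : a * i a ∈ H) (x : M) :
    x ∈ omegaClosure ((· * a) '' H) ↔ x * i a ∈ H := by
  constructor
  · rintro ⟨_, ⟨h, hh, rfl⟩, e, he, hx⟩
    have hx' : h * a = e * x := hx
    have h1 := hH.2.1 _ hh _ ha
    refine hH.2.2.2 ⟨_, h1, e, he, ?_⟩
    rw [← mul_assoc, hx', mul_assoc]
  · intro h
    refine ⟨_, ⟨_, h, rfl⟩, ?_⟩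
    have := aux_le hi x 1 (aux_idem_r hi a)
    simpa only [mul_one, mul_assoc] using this

theorem aux_sub (hi : IsInverseMonoidInv M i) {H : Set M} (hH : IsClosedInvSubmonoid i H)
    {a b c m : M} (ha : a * m * i c ∈ H) (hb : b * m * i c ∈ H) {x : M} (hx : x * i a ∈ H) :
    x * i b ∈ H := by
  have h1 := hH.2.1 _ ha _ (hH.2.2.1 _ hb)
  rw [aux_inv_mul hi, aux_inv_mul hi, aux_inv_inv hi] at h1
  have h2 : a * i b ∈ H := by
    refine aux_cancel hi hH (aux_conj hi m (aux_idem_r hi c)) ?_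
    simpa only [mul_assoc] using h1
  have h3 := hH.2.1 _ hx _ h2
  refine aux_cancel hi hH (aux_idem_r hi a) ?_
  simpa only [mul_assoc] using h3

end helpers

/-- The action of `m ∈ M` on right ω-cosets of `H`, `Y ↦ (Y m)^ω` (defined on
those `Y` for which the result is again a right ω-coset), is injective. -/
theorem coset_action_injective {M : Type*} [Monoid M] (i : M → M)
    (hi : IsInverseMonoidInv M i) (H : Set M)
    (hH : IsClosedInvSubmonoid i H) (Y Z : Set M)
    (hY : IsRightOmegaCoset i H Y) (hZ : IsRightOmegaCoset i H Z) (m : M)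
    (hYm : IsRightOmegaCoset i H (omegaClosure ((· * m) '' Y)))
    (hZm : IsRightOmegaCoset i H (omegaClosure ((· * m) '' Z)))
    (heq : omegaClosure ((· * m) '' Y) = omegaClosure ((· * m) '' Z)) :
    Y = Z := by
  obtain ⟨a, ha, rfl⟩ := hY
  obtain ⟨b, hb, rfl⟩ := hZ
  obtain ⟨c, hc, hcY⟩ := hYm
  have key : ∀ d : M, d * i d ∈ H →
      d * m ∈ omegaClosure ((· * m) '' (omegaClosure ((· * d) '' H))) := fun d hd =>
    ⟨d * m, ⟨d, (aux_mem hi hH hd d).2 hd, rfl⟩, 1, one_mul 1, (one_mul _).symm⟩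
  have h1 := key a ha
  rw [hcY, aux_mem hi hH hc] at h1
  have h2 := key b hb
  rw [← heq, hcY, aux_mem hi hH hc] at h2
  ext x
  rw [aux_mem hi hH ha, aux_mem hi hH hb]
  exact ⟨aux_sub hi hH h1 h2, aux_sub hi hH h2 h1⟩
end

section
/- Let A be an alphabet equipped with an involution ι : A → A satisfying ι (ι a) = a for all a. For i = 1, 2, let (Sᵢ, δᵢ, αᵢ, βᵢ) be an inverse automaton over A: a set Sᵢ of states with transition function δᵢ : Sᵢ → A → Option Sᵢ satisfying δᵢ s a = some t if and only if δᵢ t (ι a) = some s, with initial state αᵢ and final state βᵢ. Extend δᵢ to words by δᵢ* s [] = some s and δᵢ* s (a :: w) = (δᵢ s a).bind (fun t => δᵢ* t w), and let the accepted language be Lᵢ = {w ∈ A* : δᵢ* αᵢ w = some βᵢ}. Assume each automaton is connected (for every state s ∈ Sᵢ there is a word w with δᵢ* αᵢ w = some s) and that L₁ = L₂. Then the automata are isomorphic: there is a bijection φ : S₁ → S₂ with φ α₁ = α₂, φ β₁ = β₂, and δ₂ (φ s) a = Option.map φ (δ₁ s a) for all s ∈ S₁ and a ∈ A. -/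
/-- Extension of a partial transition function `δ : S → A → Option S` to words
(lists over `A`), by iterated `Option.bind`. -/
def runWord {S A : Type*} (δ : S → A → Option S) : S → List A → Option S
  | s, [] => some s
  | s, a :: w => (δ s a).bind fun t => runWord δ t w

theorem runWord_append {S A : Type*} (δ : S → A → Option S) (u v : List A) (s : S) :
    runWord δ s (u ++ v) = (runWord δ s u).bind fun t => runWord δ t v := by
  induction u generalizing s with
  | nil => rfl
  | cons a u ih =>
    simp only [List.cons_append, runWord]
    cases δ s a with
    | none => rfl
    | some t => simpa using ih t

theorem runWord_coinj {S A : Type*} (ι : A → A) (δ : S → A → Option S)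
    (hinv : ∀ (s t : S) (a : A), δ s a = some t ↔ δ t (ι a) = some s)
    (w : List A) (s s' t : S) (h : runWord δ s w = some t) (h' : runWord δ s' w = some t) :
    s = s' := by
  induction w generalizing s s' with
  | nil => simp only [runWord, Option.some.injEq] at h h'; exact h.trans h'.symm
  | cons a w ih =>
    simp only [runWord, Option.bind_eq_some_iff] at h h'
    obtain ⟨p, hp, h⟩ := h
    obtain ⟨q, hq, h'⟩ := h'
    have e := ih p q h h'
    subst e
    rw [hinv] at hp hq
    exact Option.some.inj (hp.symm.trans hq)

theorem runWord_rev {S A : Type*} (ι : A → A) (δ : S → A → Option S)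
    (hinv : ∀ (s t : S) (a : A), δ s a = some t ↔ δ t (ι a) = some s)
    (w : List A) (s t : S) (h : runWord δ s w = some t) :
    ∃ v, runWord δ t v = some s := by
  induction w generalizing s with
  | nil => exact ⟨[], by simp only [runWord, Option.some.injEq] at h ⊢; exact h.symm⟩
  | cons a w ih =>
    simp only [runWord, Option.bind_eq_some_iff] at h
    obtain ⟨p, hp, h⟩ := h
    obtain ⟨v, hv⟩ := ih p h
    refine ⟨v ++ [ι a], ?_⟩
    rw [runWord_append, hv]
    simp [runWord, (hinv _ _ _).1 hp]

theorem runWord_transfer {A S₁ S₂ : Type*} (ι : A → A)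
    (δ₁ : S₁ → A → Option S₁) (α₁ β₁ : S₁)
    (δ₂ : S₂ → A → Option S₂) (α₂ β₂ : S₂)
    (hinv₁ : ∀ (s t : S₁) (a : A), δ₁ s a = some t ↔ δ₁ t (ι a) = some s)
    (hinv₂ : ∀ (s t : S₂) (a : A), δ₂ s a = some t ↔ δ₂ t (ι a) = some s)
    (hconn₁ : ∀ s : S₁, ∃ w : List A, runWord δ₁ α₁ w = some s)
    (hL : ∀ w : List A, runWord δ₁ α₁ w = some β₁ ↔ runWord δ₂ α₂ w = some β₂) (s : S₁) :
    ∃ t : S₂, ∀ w, runWord δ₁ α₁ w = some s → runWord δ₂ α₂ w = some t := by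
  obtain ⟨w₀, h₀⟩ := hconn₁ s
  obtain ⟨v, hv⟩ := runWord_rev ι δ₁ hinv₁ w₀ _ _ h₀
  obtain ⟨b, hb⟩ := hconn₁ β₁
  have key : ∀ w, runWord δ₁ α₁ w = some s →
      ∃ t, runWord δ₂ α₂ w = some t ∧ runWord δ₂ t (v ++ b) = some β₂ := by
    intro w hw
    have h : runWord δ₁ α₁ (w ++ (v ++ b)) = some β₁ := by
      simp [runWord_append, hw, hv, hb]
    rw [hL, runWord_append, Option.bind_eq_some_iff] at h
    exact h
  obtain ⟨t, ht, ht'⟩ := key w₀ h₀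
  refine ⟨t, fun w hw => ?_⟩
  obtain ⟨t', h1, h2⟩ := key w hw
  rw [h1, runWord_coinj ι δ₂ hinv₂ _ _ _ _ h2 ht']

/-- Two connected inverse automata over an involutive alphabet accepting the
same language are isomorphic: there is a bijection of states preserving the
initial state, the final state and all transitions. -/
theorem inverse_automata_same_language_isomorphic {A S₁ S₂ : Type*}
    (ι : A → A) (hι : ∀ a : A, ι (ι a) = a)
    (δ₁ : S₁ → A → Option S₁) (α₁ β₁ : S₁)
    (δ₂ : S₂ → A → Option S₂) (α₂ β₂ : S₂)
    (hinv₁ : ∀ (s t : S₁) (a : A), δ₁ s a = some t ↔ δ₁ t (ι a) = some s)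
    (hinv₂ : ∀ (s t : S₂) (a : A), δ₂ s a = some t ↔ δ₂ t (ι a) = some s)
    (hconn₁ : ∀ s : S₁, ∃ w : List A, runWord δ₁ α₁ w = some s)
    (hconn₂ : ∀ s : S₂, ∃ w : List A, runWord δ₂ α₂ w = some s)
    (hL : ∀ w : List A, runWord δ₁ α₁ w = some β₁ ↔ runWord δ₂ α₂ w = some β₂) :
    ∃ φ : S₁ → S₂, Function.Bijective φ ∧ φ α₁ = α₂ ∧ φ β₁ = β₂ ∧
      ∀ (s : S₁) (a : A), δ₂ (φ s) a = Option.map φ (δ₁ s a) := by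
  choose φ hφ using runWord_transfer ι δ₁ α₁ β₁ δ₂ α₂ β₂ hinv₁ hinv₂ hconn₁ hL
  choose ψ hψ using runWord_transfer ι δ₂ α₂ β₂ δ₁ α₁ β₁ hinv₂ hinv₁ hconn₂ (fun w => (hL w).symm)
  refine ⟨φ, Function.bijective_iff_has_inverse.2 ⟨ψ, fun s => ?_, fun t => ?_⟩, ?_, ?_, ?_⟩
  · obtain ⟨w, hw⟩ := hconn₁ s
    exact Option.some.inj ((hψ _ w (hφ s w hw)).symm.trans hw)
  · obtain ⟨w, hw⟩ := hconn₂ t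
    exact Option.some.inj ((hφ _ w (hψ t w hw)).symm.trans hw)
  · exact (Option.some.inj (hφ α₁ [] rfl)).symm
  · obtain ⟨w, hw⟩ := hconn₁ β₁
    exact Option.some.inj ((hφ _ w hw).symm.trans ((hL w).1 hw))
  · intro s a
    obtain ⟨w, hw⟩ := hconn₁ s
    have hw₂ := hφ s w hw
    have e₁ : runWord δ₁ α₁ (w ++ [a]) = δ₁ s a := by
      simp [runWord_append, hw, runWord]
    have e₂ : runWord δ₂ α₂ (w ++ [a]) = δ₂ (φ s) a := by
      simp [runWord_append, hw₂, runWord]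
    cases h : δ₁ s a with
    | some t => rw [← e₂, hφ t _ (e₁.trans h)]; rfl
    | none =>
      cases h' : δ₂ (φ s) a with
      | none => rfl
      | some t =>
        have := hψ t _ (e₂.trans h')
        rw [e₁, h] at this
        cases this
end
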